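/- Let X = Y = ℂ⁴, let ρ_k = |φ_k⟩⟨φ_k| for k = 1, 2, 3, 4 be the Yu–Duan–Ying states, and let H = (1/16)( 1_X ⊗ 1_Y − T_X( vec(V) vec(V)* ) ) where V = i σ₂ ⊗ σ₃ is the 4×4 matrix with rows (0,0,1,0), (0,0,0,−1), (−1,0,0,0), (0,1,0,0). Then Tr(H) = 3/4 and, for each k = 1, 2, 3, 4, the operator H − (1/4) ρ_k is block positive with respect to X : Y. -/

import Mathlib

open Matrix Complex
open scoped Matrix Kronecker ComplexOrder

noncomputable section

/-- The tensor (Kronecker) product of two vectors. -/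
def tens {α β : Type*} (u : α → ℂ) (v : β → ℂ) : α × β → ℂ := fun p => u p.1 * v p.2

/-- The rank-one operator `u u*`. -/
def proj {α : Type*} (u : α → ℂ) : Matrix α α ℂ := Matrix.vecMulVec u (star u)

/-- A separable (positive semidefinite) operator with respect to the bipartition `α : β`. -/
def SepMat {α β : Type*} [Fintype α] [Fintype β] (P : Matrix (α × β) (α × β) ℂ) : Prop :=
  ∃ (M : ℕ) (Q : Fin M → Matrix α α ℂ) (R : Fin M → Matrix β β ℂ),
    (∀ j, (Q j).PosSemidef) ∧ (∀ j, (R j).PosSemidef) ∧ P = ∑ j, Q j ⊗ₖ R j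

/-- The operator `(1 ⊗ y)* H (1 ⊗ y)` on the first factor. -/
def blockCompress {α β : Type*} [Fintype β] (H : Matrix (α × β) (α × β) ℂ) (y : β → ℂ) :
    Matrix α α ℂ :=
  Matrix.of fun i j => ∑ a, ∑ b, star (y a) * H (i, a) (j, b) * y b

/-- Block positivity with respect to the bipartition `α : β`. -/
def BlockPositive {α β : Type*} [Fintype α] [Fintype β] (H : Matrix (α × β) (α × β) ℂ) : Prop :=
  ∀ y : β → ℂ, (blockCompress H y).PosSemidef

/-- Partial transposition on the first tensor factor. -/
def ptFst {α β : Type*} (M : Matrix (α × β) (α × β) ℂ) : Matrix (α × β) (α × β) ℂ :=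
  Matrix.of fun r c => M (c.1, r.2) (r.1, c.2)

/-- The Yu–Duan–Ying states in `ℂ⁴ ⊗ ℂ⁴`. -/
def ydyVec : Fin 4 → (Fin 4 × Fin 4) → ℂ :=
  ![fun p => if p.1 = p.2 then 1 / 2 else 0,
    fun p => if (p.1 : ℕ) + (p.2 : ℕ) = 3 then 1 / 2 else 0,
    fun p => if p = (0, 3) ∨ p = (1, 2) then 1 / 2
             else if p = (2, 1) ∨ p = (3, 0) then -(1 / 2) else 0,
    fun p => if p = (0, 1) ∨ p = (1, 0) then 1 / 2
             else if p = (2, 3) ∨ p = (3, 2) then -(1 / 2) else 0]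

/-- The vectorization `vec(U)` of a matrix, determined by `vec(|k⟩⟨j|) = |k⟩|j⟩`. -/
def vecM {n : ℕ} (U : Matrix (Fin n) (Fin n) ℂ) : Fin n × Fin n → ℂ := fun p => U p.1 p.2

/-- The matrix `V = i σ₂ ⊗ σ₃`. -/
def ydyV : Matrix (Fin 4) (Fin 4) ℂ :=
  !![0, 0, 1, 0;
     0, 0, 0, -1;
     -1, 0, 0, 0;
     0, 1, 0, 0]

/-- The dual solution `H = (1/16)(1 ⊗ 1 − T_X(vec(V)vec(V)*))`. -/
def ydyH : Matrix (Fin 4 × Fin 4) (Fin 4 × Fin 4) ℂ :=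
  (1 / 16 : ℂ) • ((1 : Matrix (Fin 4 × Fin 4) (Fin 4 × Fin 4) ℂ) - ptFst (proj (vecM ydyV)))


/-- Bessel's inequality in matrix form. -/
theorem bessel_psd (s : ℂ) (a b : Fin 4 → ℂ) (ha : star a ⬝ᵥ a = s) (hb : star b ⬝ᵥ b = s)
    (hab : star a ⬝ᵥ b = 0) :
    (s • (1 : Matrix (Fin 4) (Fin 4) ℂ) - proj a - proj b).PosSemidef := by
  have hs : 0 ≤ s := by rw [← ha]; exact dotProduct_star_self_nonneg a
  have hba : star b ⬝ᵥ a = 0 := by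
    have := congrArg star hab
    rw [star_dotProduct] at this
    simpa [dotProduct_comm] using this
  have hH : ∀ c : Fin 4 → ℂ, (proj c)ᴴ = proj c := by
    intro c
    ext i j
    simp [proj, vecMulVec_apply, mul_comm]
  have hss : star s = s := (IsSelfAdjoint.of_nonneg hs).star_eq
  have key : (s • (1 : Matrix (Fin 4) (Fin 4) ℂ) - proj a - proj b)ᴴ *
      (s • (1 : Matrix (Fin 4) (Fin 4) ℂ) - proj a - proj b)
      = s • (s • (1 : Matrix (Fin 4) (Fin 4) ℂ) - proj a - proj b) := by
    have haa : proj a * proj a = s • proj a := by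
      simp only [proj, vecMulVec_mul_vecMulVec, ha]; ext; simp [vecMulVec_apply]; ring
    have hbb : proj b * proj b = s • proj b := by
      simp only [proj, vecMulVec_mul_vecMulVec, hb]; ext; simp [vecMulVec_apply]; ring
    have h1 : proj a * proj b = 0 := by
      simp only [proj, vecMulVec_mul_vecMulVec, hab]; ext; simp [vecMulVec_apply]
    have h2 : proj b * proj a = 0 := by
      simp only [proj, vecMulVec_mul_vecMulVec, hba]; ext; simp [vecMulVec_apply]
    simp only [conjTranspose_sub, conjTranspose_smul, hH, hss, conjTranspose_one, sub_mul, mul_sub,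
      haa, hbb, h1, h2, smul_mul_assoc, mul_smul_comm, one_mul, mul_one]
    module
  by_cases h0 : s = 0
  · subst h0
    have ha0 : a = 0 := dotProduct_star_self_eq_zero.1 ha
    have hb0 : b = 0 := dotProduct_star_self_eq_zero.1 hb
    have : proj (0 : Fin 4 → ℂ) = 0 := by ext; simp [proj, vecMulVec_apply]
    simp only [ha0, hb0, this]
    simpa using Matrix.PosSemidef.zero
  · have h3 := (posSemidef_conjTranspose_mul_self
      (s • (1 : Matrix (Fin 4) (Fin 4) ℂ) - proj a - proj b)).smul (inv_nonneg.2 hs)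
    rw [key, smul_smul, inv_mul_cancel₀ h0, one_smul] at h3
    exact h3

theorem compress_eq (V : Matrix (Fin 4) (Fin 4) ℂ) (φ : Fin 4 × Fin 4 → ℂ) (y : Fin 4 → ℂ) :
    blockCompress ((1 / 16 : ℂ) • ((1 : Matrix (Fin 4 × Fin 4) (Fin 4 × Fin 4) ℂ)
      - ptFst (proj (vecM V))) - (1 / 4 : ℂ) • proj φ) y =
    (1 / 16 : ℂ) • ((star y ⬝ᵥ y) • (1 : Matrix (Fin 4) (Fin 4) ℂ)
      - proj (fun i => ∑ c, star (V i c) * y c) - proj (fun i => ∑ c, 2 * φ (i, c) * star (y c))) := by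
  ext i j
  by_cases h : i = j
  · subst h
    simp [blockCompress, ptFst, proj, vecM, vecMulVec_apply, Fin.sum_univ_four, dotProduct,
      Matrix.one_apply]
    ring
  · simp [blockCompress, ptFst, proj, vecM, vecMulVec_apply, Fin.sum_univ_four, dotProduct,
      Matrix.one_apply, h]
    ring

/-- `H = (1/16)(1 ⊗ 1 − T_X(vec(V)vec(V)*))` has trace `3/4` and is dual feasible for the
separable discrimination of the Yu–Duan–Ying states: `H − (1/4)ρ_k` is block positive for
each `k`. -/
theorem ydy_dual_feasible :
    ydyH.trace = 3 / 4 ∧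
    ∀ k : Fin 4, BlockPositive (ydyH - (1 / 4 : ℂ) • proj (ydyVec k)) := by
  constructor
  · simp [ydyH, Matrix.trace, ptFst, proj, vecM, ydyV, vecMulVec_apply, Fintype.sum_prod_type,
      Fin.sum_univ_four]
    norm_num
  · intro k y
    rw [ydyH, compress_eq]
    refine PosSemidef.smul (bessel_psd _ _ _ ?_ ?_ ?_) (by
      rw [one_div]; exact inv_nonneg.2 (by norm_num))
    · simp [ydyV, dotProduct, Fin.sum_univ_four]
      ring
    · fin_cases k <;> simp [ydyVec, dotProduct, Fin.sum_univ_four] <;> ring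
    · fin_cases k <;> simp [ydyV, ydyVec, dotProduct, Fin.sum_univ_four] <;> ring
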